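/- (Dual certificate, unknown sizes.) Let A be a symmetric n×n real matrix and ω ∈ ℝ. Suppose there exist ν ∈ ℝⁿ and a symmetric n×n matrix Γ such that, setting Λ := diag(ν) + ω·J − A − Γ: (i) Λ is positive semidefinite; (ii) Γ_{uv} = 0 whenever u and v lie in the same community; (iii) Γ_{uv} > 0 whenever u and v lie in different communities; (iv) the kernel of Λ, viewed as a linear map ℝⁿ → ℝⁿ, equals the span of {1_{S_i} − 1_{S_j} : i ≠ j}. Then the centered partition matrix X̂ is the unique maximizer of ⟨A,X⟩ − ω·⟨J,X⟩ over the unknown-sizes feasible region. -/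

import Mathlib

open Finset

/-- The centered partition matrix of the partition induced by `σ`. -/
noncomputable def centeredPartitionMatrix (n r : ℕ) (σ : Fin n → Fin r) :
    Matrix (Fin n) (Fin n) ℝ :=
  Matrix.of fun u v => if σ u = σ v then 1 else -1 / ((r : ℝ) - 1)

/-- The indicator vector `1_{S_i} ∈ ℝⁿ` of community `i`. -/
def communityIndicator (n r : ℕ) (σ : Fin n → Fin r) (i : Fin r) : Fin n → ℝ :=
  fun u => if σ u = i then 1 else 0

/-- The Frobenius inner product `⟨A,X⟩ = Σ_{u,v} A_{uv} X_{uv}`. -/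
noncomputable def frobInner {n : ℕ} (A X : Matrix (Fin n) (Fin n) ℝ) : ℝ :=
  ∑ u, ∑ v, A u v * X u v

/-- The unknown-sizes feasible region: PSD matrices with unit diagonal and
entries at least `−1/(r−1)`. -/
def feasUnknown (n r : ℕ) : Set (Matrix (Fin n) (Fin n) ℝ) :=
  {X | X.PosSemidef ∧ (∀ u, X u u = 1) ∧ (∀ u v, -1 / ((r : ℝ) - 1) ≤ X u v)}

/-- The centered partition matrix is a multiple of the Gram matrix of the vectors `e_{σ u} - 1/r`. -/
lemma centeredPartitionMatrix_posSemidef {n r : ℕ} (hr : 2 ≤ r) (σ : Fin n → Fin r) :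
    (centeredPartitionMatrix n r σ).PosSemidef := by
  have hr' : (2 : ℝ) ≤ r := by exact_mod_cast hr
  have hr1 : (r : ℝ) - 1 ≠ 0 := by linarith
  have hr0 : (r : ℝ) ≠ 0 := by linarith
  let B : Matrix (Fin r) (Fin n) ℝ :=
    Matrix.of fun i u => (if σ u = i then 1 else 0) - 1 / (r : ℝ)
  have h : centeredPartitionMatrix n r σ = ((r : ℝ) / (r - 1)) • (B.conjTranspose * B) := by
    ext u v
    have hsum : ∑ i, B i u * B i v = (if σ u = σ v then 1 else 0) - 1 / (r : ℝ) := by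
      have hterm : ∀ i, B i u * B i v =
          (if σ u = i then (if σ u = σ v then 1 else 0) - 1 / (r : ℝ) else 0) -
            (if σ v = i then 1 / (r : ℝ) else 0) + 1 / (r : ℝ) * (1 / r) := by
        intro i
        simp only [B, Matrix.of_apply]
        split_ifs <;> first | ring1 | simp_all
      simp only [hterm, sum_add_distrib, sum_sub_distrib, sum_ite_eq, mem_univ, if_true, sum_const,
        card_univ, Fintype.card_fin, nsmul_eq_mul]
      field_simp
      ring
    simp only [Matrix.smul_apply, Matrix.mul_apply, Matrix.conjTranspose_apply, star_trivial,
      smul_eq_mul, hsum, centeredPartitionMatrix, Matrix.of_apply]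
    split_ifs <;> field_simp
    ring
  rw [h]
  exact (Matrix.posSemidef_conjTranspose_mul_self B).smul (div_nonneg (by linarith) (by linarith))

lemma centeredPartitionMatrix_mem_feasUnknown {n r : ℕ} (hr : 2 ≤ r) (σ : Fin n → Fin r) :
    centeredPartitionMatrix n r σ ∈ feasUnknown n r := by
  have hr' : (2 : ℝ) ≤ r := by exact_mod_cast hr
  refine ⟨centeredPartitionMatrix_posSemidef hr σ, fun u => by simp [centeredPartitionMatrix],
    fun u v => ?_⟩
  simp only [centeredPartitionMatrix, Matrix.of_apply]
  split_ifs
  · exact (div_nonpos_of_nonpos_of_nonneg (by norm_num) (by linarith)).trans zero_le_one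
  · exact le_rfl

lemma centeredPartitionMatrix_row_mem_span {n r : ℕ} (hr : 2 ≤ r) (σ : Fin n → Fin r)
    (u : Fin n) :
    centeredPartitionMatrix n r σ u ∈ Submodule.span ℝ {w : Fin n → ℝ |
      ∃ i j : Fin r, i ≠ j ∧ w = communityIndicator n r σ i - communityIndicator n r σ j} := by
  have hr' : (2 : ℝ) ≤ r := by exact_mod_cast hr
  have hr1 : (r : ℝ) - 1 ≠ 0 := by linarith
  have h : centeredPartitionMatrix n r σ u = (1 / ((r : ℝ) - 1)) •
      ∑ i, (communityIndicator n r σ (σ u) - communityIndicator n r σ i) := by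
    ext v
    simp only [centeredPartitionMatrix, Matrix.of_apply, communityIndicator, Pi.smul_apply,
      Finset.sum_apply, Pi.sub_apply, smul_eq_mul, sum_sub_distrib, Pi.mul_apply,
      Pi.natCast_apply, sum_const, card_univ, Fintype.card_fin, nsmul_eq_mul, sum_ite_eq,
      mem_univ, if_true, eq_comm (a := σ u)]
    split_ifs <;> field_simp
    ring
  rw [h]
  refine Submodule.smul_mem _ _ (Submodule.sum_mem _ fun i _ => ?_)
  by_cases hi : σ u = i
  · simp [hi]
  · exact Submodule.subset_span ⟨_, _, hi, rfl⟩

lemma eq_of_mem_span_communityIndicator_sub {n r : ℕ} {σ : Fin n → Fin r} {w : Fin n → ℝ}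
    (hw : w ∈ Submodule.span ℝ {w : Fin n → ℝ |
      ∃ i j : Fin r, i ≠ j ∧ w = communityIndicator n r σ i - communityIndicator n r σ j})
    {u v : Fin n} (huv : σ u = σ v) : w u = w v := by
  induction hw using Submodule.span_induction with
  | mem x hx =>
    obtain ⟨i, j, -, rfl⟩ := hx
    simp [communityIndicator, huv]
  | zero => rfl
  | add x y _ _ hx hy => simp [hx, hy]
  | smul a x _ hx => simp [hx]

lemma frobInner_conjTranspose_mul_self {n : ℕ} (M B : Matrix (Fin n) (Fin n) ℝ) :
    frobInner M (B.conjTranspose * B) = ∑ k, B k ⬝ᵥ M.mulVec (B k) := by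
  simp only [frobInner, Matrix.mul_apply, Matrix.conjTranspose_apply, star_trivial, dotProduct,
    Matrix.mulVec, mul_sum]
  rw [sum_comm (s := univ) (f := fun k u => ∑ v, B k u * (M u v * B k v))]
  refine sum_congr rfl fun u _ => ?_
  rw [sum_comm]
  exact sum_congr rfl fun k _ => sum_congr rfl fun v _ => by ring

lemma exists_eq_conjTranspose_mul_self {n : ℕ} {X : Matrix (Fin n) (Fin n) ℝ}
    (hX : X.PosSemidef) : ∃ B : Matrix (Fin n) (Fin n) ℝ, X = B.conjTranspose * B := by
  open scoped MatrixOrder in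
  obtain ⟨B, hB⟩ := CStarAlgebra.nonneg_iff_eq_star_mul_self.mp hX.nonneg
  exact ⟨B, hB⟩

lemma frobInner_nonneg {n : ℕ} {M X : Matrix (Fin n) (Fin n) ℝ} (hM : M.PosSemidef)
    (hX : X.PosSemidef) : 0 ≤ frobInner M X := by
  obtain ⟨B, rfl⟩ := exists_eq_conjTranspose_mul_self hX
  rw [frobInner_conjTranspose_mul_self]
  exact sum_nonneg fun k _ => by simpa using hM.dotProduct_mulVec_nonneg (B k)

/-- If two positive semidefinite matrices are orthogonal, one of them is the Gram matrix of the
columns of a matrix whose rows lie in the kernel of the other. -/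
lemma exists_factor_of_frobInner_eq_zero {n : ℕ} {M X : Matrix (Fin n) (Fin n) ℝ}
    (hM : M.PosSemidef) (hX : X.PosSemidef) (h : frobInner M X = 0) :
    ∃ B : Matrix (Fin n) (Fin n) ℝ, X = B.conjTranspose * B ∧ ∀ k, M.mulVec (B k) = 0 := by
  obtain ⟨B, rfl⟩ := exists_eq_conjTranspose_mul_self hX
  refine ⟨B, rfl, fun k => ?_⟩
  rw [frobInner_conjTranspose_mul_self, sum_eq_zero_iff_of_nonneg
    fun k _ => by simpa using hM.dotProduct_mulVec_nonneg (B k)] at h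
  exact (hM.dotProduct_mulVec_zero_iff (B k)).1 (by simpa using h k (mem_univ k))

lemma objective_eq {n : ℕ} (A Γ : Matrix (Fin n) (Fin n) ℝ) (ω : ℝ) (ν : Fin n → ℝ)
    {X : Matrix (Fin n) (Fin n) ℝ} (hX : ∀ u, X u u = 1) :
    frobInner A X - ω * (∑ u, ∑ v, X u v) = ∑ u, ν u -
      frobInner (Matrix.diagonal ν + ω • (Matrix.of fun _ _ : Fin n => (1 : ℝ)) - A - Γ) X -
      frobInner Γ X := by
  have hd : ∑ u, ν u = ∑ u, ∑ v, Matrix.diagonal ν u v * X u v := by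
    simp [Matrix.diagonal_apply, hX]
  simp only [hd, frobInner, mul_sum, ← sum_sub_distrib]
  refine sum_congr rfl fun u _ => sum_congr rfl fun v _ => ?_
  simp only [Matrix.sub_apply, Matrix.add_apply, Matrix.smul_apply, Matrix.of_apply, smul_eq_mul]
  ring

/-- Dual certificate for the unknown-sizes SDP: if there exist `ν, Γ` with
`Λ = diag(ν) + ωJ − A − Γ ⪰ 0`, `Γ` vanishing on diagonal blocks, strictly
positive on off-diagonal blocks, and `ker Λ = span{1_{S_i} − 1_{S_j}}`, then the
centered partition matrix is the unique maximizer of `⟨A,X⟩ − ω⟨J,X⟩` over the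
unknown-sizes feasible region. -/
theorem dual_certificate_unknown_sizes (n r : ℕ) (hn : 1 ≤ n) (hr : 2 ≤ r)
    (σ : Fin n → Fin r) (hσ : Function.Surjective σ)
    (A Γ : Matrix (Fin n) (Fin n) ℝ) (ω : ℝ) (ν : Fin n → ℝ)
    (hA : A.IsSymm) (hΓsymm : Γ.IsSymm)
    (hΛpsd : (Matrix.diagonal ν + ω • (Matrix.of fun _ _ : Fin n => (1 : ℝ)) - A - Γ).PosSemidef)
    (hΓ0 : ∀ u v : Fin n, σ u = σ v → Γ u v = 0)
    (hΓpos : ∀ u v : Fin n, σ u ≠ σ v → 0 < Γ u v)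
    (hker : LinearMap.ker
        (Matrix.diagonal ν + ω • (Matrix.of fun _ _ : Fin n => (1 : ℝ)) - A - Γ).mulVecLin =
      Submodule.span ℝ {w : Fin n → ℝ |
        ∃ i j : Fin r, i ≠ j ∧ w = communityIndicator n r σ i - communityIndicator n r σ j}) :
    centeredPartitionMatrix n r σ ∈ feasUnknown n r ∧
    ∀ X ∈ feasUnknown n r, X ≠ centeredPartitionMatrix n r σ →
      frobInner A X - ω * (∑ u, ∑ v, X u v) <
        frobInner A (centeredPartitionMatrix n r σ) -
          ω * (∑ u, ∑ v, centeredPartitionMatrix n r σ u v) := by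
  have hfeas := centeredPartitionMatrix_mem_feasUnknown hr σ
  refine ⟨hfeas, fun X hX hne => ?_⟩
  rw [objective_eq A Γ ω ν hX.2.1, objective_eq A Γ ω ν hfeas.2.1]
  set Λ := Matrix.diagonal ν + ω • (Matrix.of fun _ _ : Fin n => (1 : ℝ)) - A - Γ
  have hΛ0 : frobInner Λ (centeredPartitionMatrix n r σ) = 0 := by
    refine sum_eq_zero fun u _ => ?_
    have hmem := centeredPartitionMatrix_row_mem_span hr σ u
    rw [← hker] at hmem
    have h : Λ.mulVec (centeredPartitionMatrix n r σ u) = 0 := hmem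
    exact congrFun h u
  have hterm : ∀ u v, Γ u v * centeredPartitionMatrix n r σ u v ≤ Γ u v * X u v := by
    intro u v
    by_cases huv : σ u = σ v
    · simp [hΓ0 u v huv]
    · refine mul_le_mul_of_nonneg_left ?_ (hΓpos u v huv).le
      simpa [centeredPartitionMatrix, huv] using hX.2.2 u v
  have hΛX := frobInner_nonneg hΛpsd hX.1
  have hΓX : frobInner Γ (centeredPartitionMatrix n r σ) ≤ frobInner Γ X :=
    sum_le_sum fun u _ => sum_le_sum fun v _ => hterm u v
  by_contra! hle
  have hΛX0 : frobInner Λ X = 0 := by linarith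
  have hΓeq : frobInner Γ (centeredPartitionMatrix n r σ) = frobInner Γ X := by linarith
  obtain ⟨B, hB, hBker⟩ := exists_factor_of_frobInner_eq_zero hΛpsd hX.1 hΛX0
  refine hne (Matrix.ext fun u v => ?_)
  by_cases huv : σ u = σ v
  · have hconst : X u v = X v v := by
      simp only [hB, Matrix.mul_apply, Matrix.conjTranspose_apply, star_trivial]
      refine sum_congr rfl fun k _ => ?_
      have hmem : B k ∈ LinearMap.ker Λ.mulVecLin := hBker k
      rw [hker] at hmem
      rw [eq_of_mem_span_communityIndicator_sub hmem huv]
    simp [hconst, hX.2.1, centeredPartitionMatrix, huv]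
  · have hrow := (sum_eq_sum_iff_of_le fun u _ => sum_le_sum fun v _ => hterm u v).1 hΓeq u
      (mem_univ u)
    have huvΓ := (sum_eq_sum_iff_of_le fun v _ => hterm u v).1 hrow v (mem_univ v)
    exact (mul_left_cancel₀ (hΓpos u v huv).ne' huvΓ).symm
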